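/- Fix an integer D ≥ 0 and a real number c ∈ (0,1). Then the mean square error of the estimator ĉ(j) = ((D+2j)/(M+N))² under q, rescaled by the total number of copies, converges to 4c(1−c): with M = N + D, lim_{N→∞} (2N+D) · Σ_{j=0}^{N} q_{N,M}(j,c)·( ((D+2j)/(2N+D))² − c )² = 4c(1−c). -/

import Mathlib

open Finset Filter

/-- The outcome distribution `q_{N,M}(j,c)` of the optimal (weak Schur sampling)
measurement for estimating the squared overlap `c`, given `N` and `M ≥ N` copies. -/
noncomputable def overlapDist (N M j : ℕ) (c : ℝ) : ℝ :=
  (((M - N + 2 * j + 1) * Nat.factorial N * Nat.factorial M : ℕ) : ℝ) /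
      ((Nat.factorial (N - j) * Nat.factorial (M + j + 1) : ℕ) : ℝ) *
    ∑ m ∈ Finset.range (M - N + j + 1),
      ((Nat.choose (M - N + j) m * Nat.choose (j + m) m : ℕ) : ℝ) * c ^ m * (1 - c) ^ (M - m)


namespace OverlapEstimation

/-- The Casimir shift `J(J+1) - J₀(J₀+1)` for `J = D/2 + j` and `J₀ = D/2`. -/
def casimir (D j : ℕ) : ℝ := (j : ℝ) * (j + D + 1)

/-- The prefactor of `overlapDist N (N + D) j` without the dimension factor `D + 2j + 1`. -/
noncomputable def weight (N D j : ℕ) : ℝ :=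
  (N.descFactorial j * (N + D).factorial : ℝ) / (N + D + j + 1).factorial

/-- The coefficient of `c ^ m * (1 - c) ^ (M - m)` in the inner sum of `overlapDist`. -/
def coeff (D m j : ℕ) : ℝ := ((D + j).choose m : ℝ) * (j + m).choose m

lemma cast_choose_succ_right (n k : ℕ) :
    (n.choose (k + 1) : ℝ) * (k + 1) = n.choose k * (n - k) := by
  rcases le_or_gt k n with h | h
  · have := Nat.choose_succ_right_eq n k
    rw [← Nat.cast_sub h]
    exact_mod_cast this
  · simp [Nat.choose_eq_zero_of_lt h, Nat.choose_eq_zero_of_lt (h.trans (Nat.lt_succ_self k))]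

lemma cast_choose_succ_left (n k : ℕ) :
    ((n + 1).choose k : ℝ) * (n + 1 - k) = (n + 1) * n.choose k := by
  have h₁ := cast_choose_succ_right (n + 1) k
  have h₂ : ((n : ℝ) + 1) * n.choose k = (n + 1).choose (k + 1) * (k + 1) := by
    exact_mod_cast Nat.add_one_mul_choose_eq n k
  push_cast at h₁
  linarith

lemma weight_succ (N D j : ℕ) :
    weight N D (j + 1) * (N + D + j + 2) = weight N D j * (N - j) := by
  have hd : (N.descFactorial (j + 1) : ℝ) = (N - j) * N.descFactorial j := by
    rcases le_or_gt j N with h | h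
    · rw [Nat.descFactorial_succ, Nat.cast_mul, Nat.cast_sub h]
    · simp [Nat.descFactorial_of_lt h]
  have hf : ((N + D + (j + 1) + 1).factorial : ℝ) =
      (N + D + j + 2) * (N + D + j + 1).factorial := by
    rw [show N + D + (j + 1) + 1 = (N + D + j + 1) + 1 by ring, Nat.factorial_succ]
    push_cast
    ring
  have h₀ : ((N + D + j + 1).factorial : ℝ) ≠ 0 := by positivity
  have h₁ : (N + D + j + 2 : ℝ) ≠ 0 := by positivity
  rw [weight, weight, hd, hf]
  field_simp

lemma coeff_succ_left (D m j : ℕ) :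
    (m + 1 : ℝ) ^ 2 * coeff D (m + 1) j = (casimir D j + (D - m) * (m + 1)) * coeff D m j := by
  have h₁ := cast_choose_succ_right (D + j) m
  have h₂ : ((j + m : ℕ) + 1 : ℝ) * (j + m).choose m = (j + (m + 1)).choose (m + 1) * (m + 1) := by
    exact_mod_cast Nat.add_one_mul_choose_eq (j + m) m
  push_cast at h₁ h₂
  unfold coeff casimir
  linear_combination ((j + (m + 1)).choose (m + 1) * (m + 1) : ℝ) * h₁ -
    ((D + j).choose m * (D + j - m) : ℝ) * h₂

lemma coeff_succ_right (D m j : ℕ) :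
    (j + 1 : ℝ) * (D + j + 1 - m) * coeff D m (j + 1) =
      (D + j + 1) * (j + m + 1) * coeff D m j := by
  have h₁ := cast_choose_succ_left (D + j) m
  have h₂ := cast_choose_succ_left (j + m) m
  push_cast at h₁ h₂
  unfold coeff
  rw [show D + (j + 1) = D + j + 1 by ring, show j + 1 + m = j + m + 1 by ring]
  linear_combination ((j + m + 1).choose m * (j + 1) : ℝ) * h₁ +
    ((D + j + 1) * (D + j).choose m : ℝ) * h₂

/-- The sum over `j` of `casimir ^ k` against the coefficient of `c ^ m * (1 - c) ^ (M - m)`. -/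
noncomputable def coeffMoment (N D k m : ℕ) : ℝ :=
  ∑ j ∈ range (N + 1), (D + 2 * j + 1) * weight N D j * coeff D m j * casimir D j ^ k

lemma coeffMoment_succ (N D k m : ℕ) :
    coeffMoment N D (k + 1) m =
      (m + 1) ^ 2 * coeffMoment N D k (m + 1) - (D - m) * (m + 1) * coeffMoment N D k m := by
  simp only [coeffMoment, mul_sum, ← sum_sub_distrib]
  refine sum_congr rfl fun j _ => ?_
  linear_combination -((D + 2 * j + 1) * weight N D j * casimir D j ^ k) * coeff_succ_left D m j

lemma coeffMoment_one_eq_mul_coeffMoment_zero (N D m : ℕ) :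
    coeffMoment N D 1 m = (m + 1) * N * coeffMoment N D 0 m := by
  have h := sum_range_sub
    (fun j : ℕ => weight N D j * (N + D + j + 1) * j * (D + j - m) * coeff D m j) (N + 1)
  have hN : weight N D (N + 1) = 0 := by simp [weight]
  simp only [hN, zero_mul, Nat.cast_zero, mul_zero, sub_zero] at h
  rw [← sub_eq_zero, ← neg_eq_zero, ← h]
  simp only [coeffMoment, mul_sum, ← sum_sub_distrib, ← sum_neg_distrib]
  refine sum_congr rfl fun j _ => ?_
  have hw := weight_succ N D j
  have hc := coeff_succ_right D m j
  push_cast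
  unfold casimir
  linear_combination -((j + 1) * (D + j + 1 - m) * coeff D m (j + 1)) * hw -
    (weight N D j * (N - j)) * hc

lemma sum_weight (N D : ℕ) : ∑ j ∈ range (N + 1), (D + 2 * j + 1) * weight N D j = 1 := by
  have h := sum_range_sub' (fun j : ℕ => weight N D j * (N + D + j + 1)) (N + 1)
  have hN : weight N D (N + 1) = 0 := by simp [weight]
  have h₀ : weight N D 0 * (N + D + (0 : ℕ) + 1) = 1 := by
    have : ((N + D).factorial : ℝ) ≠ 0 := by positivity
    have : (N + D + 1 : ℝ) ≠ 0 := by positivity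
    simp only [weight, Nat.descFactorial_zero, add_zero, Nat.factorial_succ]
    push_cast
    field_simp
    simp
  rw [hN, h₀, zero_mul, sub_zero] at h
  refine Eq.trans ?_ h
  refine sum_congr rfl fun j _ => ?_
  have hw := weight_succ N D j
  push_cast
  linear_combination hw

lemma coeffMoment_zero (N D m : ℕ) : coeffMoment N D 0 m = (N + D).choose m := by
  induction m with
  | zero => simpa [coeffMoment, coeff] using sum_weight N D
  | succ m ih =>
    have h₁ := coeffMoment_succ N D 0 m
    have h₂ := coeffMoment_one_eq_mul_coeffMoment_zero N D m
    have h₃ := cast_choose_succ_right (N + D) m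
    rw [zero_add, h₂, ih] at h₁
    push_cast at h₃
    have : (m + 1 : ℝ) ^ 2 ≠ 0 := by positivity
    apply mul_left_cancel₀ this
    linear_combination -h₁ - (m + 1 : ℝ) * h₃

lemma coeffMoment_one (N D m : ℕ) :
    coeffMoment N D 1 m = (m + 1) * N * (N + D).choose m := by
  rw [coeffMoment_one_eq_mul_coeffMoment_zero, coeffMoment_zero]

lemma coeffMoment_two (N D m : ℕ) :
    coeffMoment N D 2 m =
      N * (m + 1) * ((m + 1) * N + (N + D - m)) * (N + D).choose m := by
  have h := cast_choose_succ_right (N + D) m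
  rw [coeffMoment_succ, coeffMoment_one, coeffMoment_one]
  push_cast at h ⊢
  linear_combination ((m + 1) * (m + 2) * N : ℝ) * h

lemma overlapDist_eq {N D j : ℕ} (hj : j ≤ N) (c : ℝ) :
    overlapDist N (N + D) j c = (D + 2 * j + 1) * weight N D j *
      ∑ m ∈ range (N + D + 1), coeff D m j * (c ^ m * (1 - c) ^ (N + D - m)) := by
  unfold overlapDist
  rw [Nat.add_sub_cancel_left]
  congr 1
  · have h : (N.factorial : ℝ) = (N - j).factorial * N.descFactorial j := by
      exact_mod_cast (Nat.factorial_mul_descFactorial hj).symm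
    have h₀ : ((N - j).factorial : ℝ) ≠ 0 := by positivity
    have h₁ : ((N + D + j + 1).factorial : ℝ) ≠ 0 := by positivity
    unfold weight
    push_cast
    rw [h]
    field_simp
  · rw [← sum_subset (range_mono (show D + j + 1 ≤ N + D + 1 by omega))]
    · refine sum_congr rfl fun m _ => ?_
      unfold coeff
      push_cast
      ring
    · intro m _ hm
      have : D + j < m := by simpa using hm
      simp [coeff, Nat.choose_eq_zero_of_lt this]

lemma overlapDist_nonneg (N M j : ℕ) {c : ℝ} (h₀ : 0 ≤ c) (h₁ : c ≤ 1) :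
    0 ≤ overlapDist N M j c := by
  have : 0 ≤ 1 - c := sub_nonneg.2 h₁
  unfold overlapDist
  positivity

/-- The `k`-th moment of the Casimir shift under the outcome distribution. -/
noncomputable def casimirMoment (N D k : ℕ) (c : ℝ) : ℝ :=
  ∑ j ∈ range (N + 1), overlapDist N (N + D) j c * casimir D j ^ k

lemma casimirMoment_eq (N D k : ℕ) (c : ℝ) :
    casimirMoment N D k c =
      ∑ m ∈ range (N + D + 1), coeffMoment N D k m * (c ^ m * (1 - c) ^ (N + D - m)) := by
  simp only [coeffMoment, sum_mul]
  rw [sum_comm]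
  refine sum_congr rfl fun j hj => ?_
  rw [overlapDist_eq (Nat.lt_succ_iff.1 (mem_range.1 hj)), mul_sum, sum_mul]
  refine sum_congr rfl fun m _ => ?_
  ring

lemma sum_binomial (M : ℕ) (c : ℝ) :
    ∑ m ∈ range (M + 1), (M.choose m : ℝ) * (c ^ m * (1 - c) ^ (M - m)) = 1 := by
  have h := congrArg (Polynomial.eval c) (bernsteinPolynomial.sum ℝ M)
  simpa [Polynomial.eval_finsetSum, bernsteinPolynomial, mul_assoc] using h

lemma sum_mul_binomial (M : ℕ) (c : ℝ) :
    ∑ m ∈ range (M + 1), (m : ℝ) * ((M.choose m : ℝ) * (c ^ m * (1 - c) ^ (M - m))) = M * c := by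
  have h := congrArg (Polynomial.eval c) (bernsteinPolynomial.sum_smul ℝ M)
  simpa [Polynomial.eval_finsetSum, bernsteinPolynomial, mul_assoc] using h

lemma cast_mul_pred (m : ℕ) : (m : ℝ) * ((m - 1 : ℕ) : ℝ) = m * (m - 1) := by
  cases m <;> simp

lemma sum_mul_pred_binomial (M : ℕ) (c : ℝ) :
    ∑ m ∈ range (M + 1), (m * (m - 1) : ℝ) *
      ((M.choose m : ℝ) * (c ^ m * (1 - c) ^ (M - m))) = M * (M - 1) * c ^ 2 := by
  have h := congrArg (Polynomial.eval c) (bernsteinPolynomial.sum_mul_smul ℝ M)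
  simpa [Polynomial.eval_finsetSum, bernsteinPolynomial, mul_assoc, cast_mul_pred,
    ← mul_assoc (Nat.cast _ : ℝ) (Nat.cast (_ - 1))] using h

lemma casimirMoment_zero (N D : ℕ) (c : ℝ) : casimirMoment N D 0 c = 1 := by
  simp only [casimirMoment_eq, coeffMoment_zero, sum_binomial]

lemma casimirMoment_one (N D : ℕ) (c : ℝ) :
    casimirMoment N D 1 c = N * ((N + D) * c + 1) := by
  have h₀ := sum_binomial (N + D) c
  have h₁ := sum_mul_binomial (N + D) c
  push_cast at h₁
  rw [← h₁, add_comm _ (1 : ℝ)]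
  refine Eq.trans ?_ (congrArg (fun x : ℝ => N * (x + _)) h₀)
  rw [casimirMoment_eq, ← sum_add_distrib, mul_sum]
  refine sum_congr rfl fun m _ => ?_
  rw [coeffMoment_one]
  ring

lemma casimirMoment_two (N D : ℕ) (c : ℝ) :
    casimirMoment N D 2 c =
      N * ((N - 1) * ((N + D) * (N + D - 1) * c ^ 2) + (4 * N + D - 2) * ((N + D) * c) +
        (2 * N + D)) := by
  have h₀ := sum_binomial (N + D) c
  have h₁ := sum_mul_binomial (N + D) c
  have h₂ := sum_mul_pred_binomial (N + D) c
  push_cast at h₁ h₂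
  have e : casimirMoment N D 2 c = N * ((N - 1) * (∑ m ∈ range (N + D + 1), (m * (m - 1) : ℝ) *
        (((N + D).choose m : ℝ) * (c ^ m * (1 - c) ^ (N + D - m)))) +
      (4 * N + D - 2) * (∑ m ∈ range (N + D + 1), (m : ℝ) *
        (((N + D).choose m : ℝ) * (c ^ m * (1 - c) ^ (N + D - m)))) +
      (2 * N + D) * ∑ m ∈ range (N + D + 1),
        ((N + D).choose m : ℝ) * (c ^ m * (1 - c) ^ (N + D - m))) := by
    rw [casimirMoment_eq]
    simp only [mul_sum, ← sum_add_distrib]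
    refine sum_congr rfl fun m _ => ?_
    rw [coeffMoment_two]
    ring
  rw [e, h₀, h₁, h₂, mul_one]

lemma casimir_mse_eq (N D : ℕ) (c : ℝ) (hn : (2 * N + D : ℝ) ≠ 0) :
    (2 * N + D : ℝ) * ∑ j ∈ range (N + 1), overlapDist N (N + D) j c *
        (4 * casimir D j / (2 * N + D) ^ 2 - c) ^ 2 =
      4 * c * (1 - c) + (4 * c ^ 2 - 8 * c + 8) * (2 * N + D : ℝ)⁻¹ +
        (4 * D ^ 2 * c ^ 2 - 8 * D ^ 2 * c - 8 * D) * (2 * N + D : ℝ)⁻¹ ^ 2 +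
        ((D ^ 4 - 4 * D ^ 2) * c ^ 2 + (4 * D ^ 3 + 8 * D ^ 2) * c) *
          (2 * N + D : ℝ)⁻¹ ^ 3 := by
  have h : ∑ j ∈ range (N + 1), overlapDist N (N + D) j c *
        (4 * casimir D j / (2 * N + D) ^ 2 - c) ^ 2 =
      16 / (2 * N + D : ℝ) ^ 4 * casimirMoment N D 2 c -
        8 * c / (2 * N + D) ^ 2 * casimirMoment N D 1 c + c ^ 2 * casimirMoment N D 0 c := by
    simp only [casimirMoment, mul_sum, ← sum_sub_distrib, ← sum_add_distrib]
    refine sum_congr rfl fun j _ => ?_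
    field_simp
    ring
  rw [h, casimirMoment_zero, casimirMoment_one, casimirMoment_two]
  field_simp
  ring

lemma tendsto_inv_copies (D : ℕ) :
    Tendsto (fun N : ℕ => (2 * N + D : ℝ)⁻¹) atTop (nhds 0) := by
  refine tendsto_inv_atTop_zero.comp (tendsto_atTop_add_const_right _ _ ?_)
  exact tendsto_natCast_atTop_atTop.const_mul_atTop two_pos

lemma casimir_mse_tendsto (D : ℕ) (c : ℝ) :
    Tendsto (fun N : ℕ => (2 * N + D : ℝ) * ∑ j ∈ range (N + 1), overlapDist N (N + D) j c *
        (4 * casimir D j / (2 * N + D) ^ 2 - c) ^ 2) atTop (nhds (4 * c * (1 - c))) := by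
  have h := tendsto_inv_copies D
  have key := (((h.const_mul (4 * c ^ 2 - 8 * c + 8)).const_add (4 * c * (1 - c))).add
    ((h.pow 2).const_mul (4 * D ^ 2 * c ^ 2 - 8 * D ^ 2 * c - 8 * D))).add
    ((h.pow 3).const_mul ((D ^ 4 - 4 * D ^ 2) * c ^ 2 + (4 * D ^ 3 + 8 * D ^ 2) * c))
  norm_num only [mul_zero, add_zero] at key
  refine key.congr' ?_
  filter_upwards [eventually_gt_atTop 0] with N hN
  exact (casimir_mse_eq N D c (by positivity)).symm

/-- The estimator differs from the rescaled Casimir by at most `(D + 2) ^ 2 / (M + N)`. -/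
lemma abs_estimator_sub_casimir_le {N D j : ℕ} (hj : j ≤ N) (hN : 0 < N) :
    |((D + 2 * j : ℝ) / (2 * N + D)) ^ 2 - 4 * casimir D j / (2 * N + D) ^ 2| ≤
      (D + 2) ^ 2 * (2 * N + D : ℝ)⁻¹ := by
  have hN' : (1 : ℝ) ≤ N := by exact_mod_cast hN
  have hj' : (j : ℝ) ≤ N := by exact_mod_cast hj
  have hn : (0 : ℝ) < 2 * N + D := by positivity
  have hD : (0 : ℝ) ≤ D := D.cast_nonneg
  have hj₀ : (0 : ℝ) ≤ j := j.cast_nonneg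
  have e : ((D + 2 * j : ℝ) / (2 * N + D)) ^ 2 - 4 * casimir D j / (2 * N + D) ^ 2 =
      (D ^ 2 - 4 * j) * ((2 * N + D : ℝ) ^ 2)⁻¹ := by
    unfold casimir
    field_simp
    ring
  rw [e, abs_mul, abs_of_pos (a := ((2 * N + D : ℝ) ^ 2)⁻¹) (by positivity),
    ← div_eq_mul_inv, ← div_eq_mul_inv, div_le_div_iff₀ (by positivity) hn]
  have : |(D ^ 2 - 4 * j : ℝ)| ≤ (D + 2) ^ 2 * (2 * N + D) := by
    rw [abs_le]
    constructor <;> nlinarith [mul_nonneg hD hD, mul_nonneg (mul_nonneg hD hD) hD,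
      mul_nonneg hD (N.cast_nonneg : (0 : ℝ) ≤ N),
      mul_nonneg (mul_nonneg hD hD) (sub_nonneg.2 hN')]
  calc |(D ^ 2 - 4 * j : ℝ)| * (2 * N + D) ≤ (D + 2) ^ 2 * (2 * N + D) * (2 * N + D) := by gcongr
    _ = _ := by ring

lemma abs_sq_add_sub_sq_le {a b K s : ℝ} (hs : 0 < s) (hb : |b| ≤ K * s ^ 2) :
    |(a + b) ^ 2 - a ^ 2| ≤ K * s * (a ^ 2 + s ^ 2) + K ^ 2 * s ^ 4 := by
  have hK : 0 ≤ K * s ^ 2 := (abs_nonneg b).trans hb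
  have hK' : 0 ≤ K := nonneg_of_mul_nonneg_left hK (by positivity)
  calc |(a + b) ^ 2 - a ^ 2| = |2 * a * b + b ^ 2| := by ring_nf
    _ ≤ |2 * a * b| + |b ^ 2| := abs_add_le _ _
    _ = 2 * |a| * |b| + |b| ^ 2 := by simp [abs_mul]
    _ ≤ 2 * |a| * (K * s ^ 2) + (K * s ^ 2) ^ 2 := by gcongr
    _ ≤ _ := by
      have := mul_nonneg (mul_nonneg hK' hs.le) (sq_nonneg (|a| - s))
      nlinarith [sq_abs a]

end OverlapEstimation

open OverlapEstimation in
/-- Fix `D ≥ 0` and `c ∈ (0,1)`. The mean square error of the estimator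
`ĉ(j) = ((D+2j)/(M+N))²` under `q`, rescaled by the total number of copies,
converges to `4c(1−c)`: with `M = N + D`,
`lim_{N→∞} (2N+D)·Σ_j q_{N,M}(j,c)·(((D+2j)/(2N+D))² − c)² = 4c(1−c)`. -/
theorem overlapEstimator_mse_tendsto (D : ℕ) (c : ℝ) (hc : c ∈ Set.Ioo (0 : ℝ) 1) :
    Tendsto (fun N : ℕ =>
        (2 * (N : ℝ) + D) *
          ∑ j ∈ Finset.range (N + 1),
            overlapDist N (N + D) j c *
              ((((D : ℝ) + 2 * j) / (2 * N + D)) ^ 2 - c) ^ 2)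
      atTop (nhds (4 * c * (1 - c))) := by
  have hA := casimir_mse_tendsto D c
  have hs : Tendsto (fun N : ℕ => √((2 * N + D : ℝ)⁻¹)) atTop (nhds 0) := by
    simpa using (tendsto_inv_copies D).sqrt
  have hbound := ((hs.mul (hA.add_const 1)).const_mul ((D + 2 : ℝ) ^ 2)).add
    ((tendsto_inv_copies D).const_mul (((D + 2 : ℝ) ^ 2) ^ 2))
  simp only [zero_mul, mul_zero, add_zero] at hbound
  have hdiff := squeeze_zero_norm' (f := fun N : ℕ =>
      (2 * (N : ℝ) + D) * ∑ j ∈ range (N + 1), overlapDist N (N + D) j c *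
          ((((D : ℝ) + 2 * j) / (2 * N + D)) ^ 2 - c) ^ 2 -
        (2 * N + D : ℝ) * ∑ j ∈ range (N + 1), overlapDist N (N + D) j c *
          (4 * casimir D j / (2 * N + D) ^ 2 - c) ^ 2) ?_ hbound
  · simpa using hdiff.add hA
  filter_upwards [eventually_gt_atTop 0] with N hN
  have hn : (0 : ℝ) < 2 * N + D := by positivity
  set n : ℝ := 2 * N + D with hn_def
  have hsq : √n⁻¹ ^ 2 = n⁻¹ := Real.sq_sqrt (by positivity)
  have hq : ∑ j ∈ range (N + 1), overlapDist N (N + D) j c = 1 := by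
    simpa [casimirMoment] using casimirMoment_zero N D c
  rw [← mul_sub, ← sum_sub_distrib, norm_mul, Real.norm_of_nonneg hn.le]
  calc n * ‖∑ j ∈ range (N + 1), (overlapDist N (N + D) j c * (((D + 2 * j : ℝ) / n) ^ 2 - c) ^ 2 -
        overlapDist N (N + D) j c * (4 * casimir D j / n ^ 2 - c) ^ 2)‖
      ≤ n * ∑ j ∈ range (N + 1), overlapDist N (N + D) j c *
          ((D + 2) ^ 2 * √n⁻¹ * ((4 * casimir D j / n ^ 2 - c) ^ 2 + √n⁻¹ ^ 2) +
            ((D + 2) ^ 2) ^ 2 * √n⁻¹ ^ 4) := by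
        gcongr
        refine norm_sum_le_of_le _ fun j hj => ?_
        have hq₀ := overlapDist_nonneg N (N + D) j hc.1.le hc.2.le
        rw [← mul_sub, norm_mul, Real.norm_of_nonneg hq₀]
        gcongr
        have hb := abs_estimator_sub_casimir_le (D := D) (Nat.lt_succ_iff.1 (mem_range.1 hj)) hN
        rw [← hn_def, ← hsq] at hb
        have := abs_sq_add_sub_sq_le (a := 4 * casimir D j / n ^ 2 - c) (by positivity) hb
        rwa [sub_add_sub_cancel'] at this
    _ = n * ((D + 2) ^ 2 * √n⁻¹ * (∑ j ∈ range (N + 1), overlapDist N (N + D) j c *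
          (4 * casimir D j / n ^ 2 - c) ^ 2) +
          ((D + 2) ^ 2 * √n⁻¹ * √n⁻¹ ^ 2 + ((D + 2) ^ 2) ^ 2 * √n⁻¹ ^ 4) *
            ∑ j ∈ range (N + 1), overlapDist N (N + D) j c) := by
        congr 1
        simp only [mul_sum, ← sum_add_distrib]
        refine sum_congr rfl fun j _ => ?_
        ring
    _ = _ := by
        rw [hq, show √n⁻¹ ^ 4 = (√n⁻¹ ^ 2) ^ 2 by ring, hsq]
        generalize √n⁻¹ = s
        generalize ∑ j ∈ range (N + 1), overlapDist N (N + D) j c *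
          (4 * casimir D j / n ^ 2 - c) ^ 2 = A
        field_simp
        ring
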